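/- arXiv:2511.08965 — 4 statements merged into one kernel-verified Lean document; each statement's English description precedes it below -/
import Mathlib

section
/- Let ℱ be an 𝒩-saturated family of subsets of [n], let 𝒢 be a component of ℱ, let T be a maximal element of 𝒢 and let S be a minimal element of 𝒢. Then S ⊆ T. -/
variable {n : ℕ}

/-- Two subsets of `[n]` are incomparable if neither contains the other. -/
def Incomp (X Y : Finset (Fin n)) : Prop := ¬ X ⊆ Y ∧ ¬ Y ⊆ X

/-- `A, B, C, D` form an induced copy of the poset `𝒩`, with maximal elements `A, B`
and minimal elements `C, D`: `C ⊂ A`, `D ⊂ A`, `D ⊂ B`, and the pairs `{A,B}`, `{C,B}`,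
`{C,D}` are incomparable.  Here `A` is the maximal element comparable to both minimal
elements and `D` is the minimal element comparable to both maximal elements. -/
def IsNCopy (A B C D : Finset (Fin n)) : Prop :=
  C ⊂ A ∧ D ⊂ A ∧ D ⊂ B ∧ Incomp A B ∧ Incomp C B ∧ Incomp C D

/-- A family contains an induced copy of `𝒩` if four of its members form such a copy. -/
def ContainsN (F : Finset (Finset (Fin n))) : Prop :=
  ∃ A B C D, A ∈ F ∧ B ∈ F ∧ C ∈ F ∧ D ∈ F ∧ IsNCopy A B C D

/-- `F` is `𝒩`-saturated: it contains no induced copy of `𝒩`, but adding any missing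
subset of `[n]` creates one. -/
def NSaturated (F : Finset (Finset (Fin n))) : Prop :=
  ¬ ContainsN F ∧ ∀ S : Finset (Fin n), S ∉ F → ContainsN (insert S F)

/-- The comparability graph on `F \ {∅, [n]}`: two distinct members of `F`, both different
from `∅` and `[n]`, are adjacent whenever one is a subset of the other.  This graph has
the same connected components as the Hasse diagram of `F \ {∅, [n]}`. -/
def compGraph (F : Finset (Finset (Fin n))) : SimpleGraph (Finset (Fin n)) where
  Adj X Y := X ≠ Y ∧ X ∈ F ∧ Y ∈ F ∧ X ≠ ∅ ∧ X ≠ Finset.univ ∧ Y ≠ ∅ ∧ Y ≠ Finset.univ ∧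
    (X ⊆ Y ∨ Y ⊆ X)
  symm := by
    constructor
    rintro X Y ⟨h1, h2, h3, h4, h5, h6, h7, h8⟩
    exact ⟨h1.symm, h3, h2, h6, h7, h4, h5, h8.symm⟩
  loopless := ⟨fun X h => h.1 rfl⟩

/-- `G` is a component of `F`: the set of vertices reachable in the comparability graph
from some member of `F \ {∅, [n]}`. -/
def IsComponent (F : Finset (Finset (Fin n))) (G : Set (Finset (Fin n))) : Prop :=
  ∃ X₀, X₀ ∈ F ∧ X₀ ≠ ∅ ∧ X₀ ≠ Finset.univ ∧ G = {Y | (compGraph F).Reachable X₀ Y}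

/-- A maximal element of a component: a member not strictly contained in any member. -/
def IsMaxIn (G : Set (Finset (Fin n))) (T : Finset (Fin n)) : Prop :=
  T ∈ G ∧ ∀ Y ∈ G, ¬ T ⊂ Y

/-- A minimal element of a component: a member not strictly containing any member. -/
def IsMinIn (G : Set (Finset (Fin n))) (S : Finset (Fin n)) : Prop :=
  S ∈ G ∧ ∀ Y ∈ G, ¬ Y ⊂ S

/-- Every vertex reachable in `compGraph F` from a member of `F` is a member of `F`. -/
theorem mem_of_compGraph_reachable {F : Finset (Finset (Fin n))} {X Y : Finset (Fin n)}
    (hX : X ∈ F) (h : (compGraph F).Reachable X Y) : Y ∈ F := by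
  rw [SimpleGraph.reachable_iff_reflTransGen] at h
  induction h with
  | refl => exact hX
  | tail _ hadj _ => exact hadj.2.2.1

/-- In a component of a family without an induced `𝒩`, a minimal element and any other
element have a common upper bound in the component. -/
theorem IsMinIn.exists_upper_bound {F : Finset (Finset (Fin n))} (hF : ¬ ContainsN F)
    {G : Set (Finset (Fin n))} (hGF : ∀ Y ∈ G, Y ∈ F)
    (hG : ∀ Y ∈ G, ∀ Z, (compGraph F).Adj Y Z → Z ∈ G)
    {S Y : Finset (Fin n)} (hS : IsMinIn G S) (h : (compGraph F).Reachable S Y) :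
    Y ∈ G ∧ ∃ X ∈ G, S ⊆ X ∧ Y ⊆ X := by
  have hmin : ∀ Y ∈ G, Y ⊆ S → S ⊆ Y := fun Y hY hYS => by
    by_contra hn
    exact hS.2 Y hY ⟨hYS, hn⟩
  rw [SimpleGraph.reachable_iff_reflTransGen] at h
  induction h with
  | refl => exact ⟨hS.1, S, hS.1, subset_rfl, subset_rfl⟩
  | @tail Y Z _ hadj ih =>
    obtain ⟨hY, X, hX, hSX, hYX⟩ := ih
    have hZ := hG Y hY Z hadj
    refine ⟨hZ, ?_⟩
    rcases hadj.2.2.2.2.2.2.2 with hYZ | hZY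
    · by_cases hSZ : S ⊆ Z
      · exact ⟨Z, hZ, hSZ, subset_rfl⟩
      by_cases hZX : Z ⊆ X
      · exact ⟨X, hX, hSX, hZX⟩
      have hZS : ¬ Z ⊆ S := fun h => hSZ (hmin Z hZ h)
      have hXZ : ¬ X ⊆ Z := fun h => hSZ (hSX.trans h)
      have hSY : ¬ S ⊆ Y := fun h => hSZ (h.trans hYZ)
      have hYS : ¬ Y ⊆ S := fun h => hSY (hmin Y hY h)
      exact absurd ⟨X, Z, S, Y, hGF X hX, hGF Z hZ, hGF S hS.1, hGF Y hY,
        ⟨hSX, fun h => hYS (hYX.trans h)⟩, ⟨hYX, fun h => hSY (hSX.trans h)⟩,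
        ⟨hYZ, fun h => hZX (h.trans hYX)⟩, ⟨hXZ, hZX⟩, ⟨hSZ, hZS⟩, ⟨hSY, hYS⟩⟩ hF
    · exact ⟨X, hX, hSX, hZY.trans hYX⟩

/-- if `T` is a maximal element and `S` a minimal element of a component `G`
of an `𝒩`-saturated family `F`, then `S ⊆ T`. -/
theorem stmt4 (n : ℕ) (F : Finset (Finset (Fin n))) (hF : NSaturated F)
    (G : Set (Finset (Fin n))) (hG : IsComponent F G)
    (T S : Finset (Fin n)) (hT : IsMaxIn G T) (hS : IsMinIn G S) :
    S ⊆ T := by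
  obtain ⟨X₀, hX₀, -, -, rfl⟩ := hG
  obtain ⟨-, X, hX, hSX, hTX⟩ := hS.exists_upper_bound hF.1
    (fun _ => mem_of_compGraph_reachable hX₀) (fun _ hY _ hadj => SimpleGraph.Reachable.trans hY hadj.reachable)
    (SimpleGraph.Reachable.trans (SimpleGraph.Reachable.symm hS.1) hT.1)
  by_contra hST
  exact hT.2 X hX ⟨hTX, fun h => hST (hSX.trans h)⟩
end

section
/- Let ℱ be an 𝒩-saturated family of subsets of [n], let 𝒢 be a component of ℱ, and let M ∈ ℱ be such that B ⊆ M for every minimal element B of 𝒢 and M ⊆ A for every maximal element A of 𝒢, with M minimal with this property (no M' ∈ ℱ with M' ⊊ M satisfies the same containments). Then every X ∈ 𝒢 is comparable to M. -/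
variable {n : ℕ}

/-- `Z` lies above every minimal element of `G` and below every maximal element of `G`. -/
def IsMiddle (G : Set (Finset (Fin n))) (Z : Finset (Fin n)) : Prop :=
  (∀ B, IsMinIn G B → B ⊆ Z) ∧ (∀ A, IsMaxIn G A → Z ⊆ A)

theorem Incomp.symm {X Y : Finset (Fin n)} (h : Incomp X Y) : Incomp Y X := ⟨h.2, h.1⟩

theorem Incomp.ne_empty {X Y : Finset (Fin n)} (h : Incomp X Y) : X ≠ ∅ := by
  rintro rfl
  exact h.1 (Finset.empty_subset _)

theorem Incomp.ne_univ {X Y : Finset (Fin n)} (h : Incomp X Y) : X ≠ Finset.univ := by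
  rintro rfl
  exact h.2 (Finset.subset_univ _)

theorem exists_isMinIn_subset {G : Set (Finset (Fin n))} {Y : Finset (Fin n)} (hY : Y ∈ G) :
    ∃ B, IsMinIn G B ∧ B ⊆ Y := by
  obtain ⟨B, hBY, hB⟩ := (Set.toFinite G).exists_le_minimal hY
  exact ⟨B, ⟨hB.prop, fun Z hZ hZB => hZB.2 (hB.le_of_le hZ hZB.1)⟩, hBY⟩

theorem exists_isMaxIn_superset {G : Set (Finset (Fin n))} {Y : Finset (Fin n)} (hY : Y ∈ G) :
    ∃ A, IsMaxIn G A ∧ Y ⊆ A := by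
  obtain ⟨A, hYA, hA⟩ := (Set.toFinite G).exists_le_maximal hY
  exact ⟨A, ⟨hA.prop, fun Z hZ hAZ => hAZ.2 (hA.le_of_ge hZ hAZ.1)⟩, hYA⟩

theorem IsMinIn.subset_of_subset {G : Set (Finset (Fin n))} {B Y : Finset (Fin n)}
    (hB : IsMinIn G B) (hY : Y ∈ G) (h : Y ⊆ B) : B ⊆ Y :=
  by_contra fun h' => hB.2 Y hY ⟨h, h'⟩

theorem IsMaxIn.subset_of_subset {G : Set (Finset (Fin n))} {A Y : Finset (Fin n)}
    (hA : IsMaxIn G A) (hY : Y ∈ G) (h : A ⊆ Y) : Y ⊆ A :=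
  by_contra fun h' => hA.2 Y hY ⟨h, h'⟩

theorem IsComponent.nonempty {F : Finset (Finset (Fin n))} {G : Set (Finset (Fin n))}
    (hG : IsComponent F G) : G.Nonempty := by
  obtain ⟨X₀, -, -, -, rfl⟩ := hG
  exact ⟨X₀, SimpleGraph.Reachable.refl X₀⟩

theorem IsComponent.mem_family {F : Finset (Finset (Fin n))} {G : Set (Finset (Fin n))}
    (hG : IsComponent F G) {Y : Finset (Fin n)} (hY : Y ∈ G) :
    Y ∈ F ∧ Y ≠ ∅ ∧ Y ≠ Finset.univ := by
  obtain ⟨X₀, h1, h2, h3, rfl⟩ := hG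
  obtain ⟨w⟩ := SimpleGraph.Reachable.symm hY
  cases w with
  | nil => exact ⟨h1, h2, h3⟩
  | cons h _ => exact ⟨h.2.1, h.2.2.2.1, h.2.2.2.2.1⟩

theorem IsComponent.mem_of_comparable {F : Finset (Finset (Fin n))} {G : Set (Finset (Fin n))}
    (hG : IsComponent F G) {Y Z : Finset (Fin n)} (hY : Y ∈ G) (hZ : Z ∈ F) (hZ0 : Z ≠ ∅)
    (hZ1 : Z ≠ Finset.univ) (h : Y ⊆ Z ∨ Z ⊆ Y) : Z ∈ G := by
  by_cases hYZ : Y = Z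
  · exact hYZ ▸ hY
  obtain ⟨hYF, hY0, hY1⟩ := hG.mem_family hY
  obtain ⟨X₀, -, -, -, rfl⟩ := hG
  have hadj : (compGraph F).Adj Y Z := ⟨hYZ, hYF, hZ, hY0, hY1, hZ0, hZ1, h⟩
  exact SimpleGraph.Reachable.trans hY hadj.reachable

/-- In an `𝒩`-free family, a member of a component incomparable to a middle set is itself a
middle set. -/
theorem IsMiddle.of_incomp {F : Finset (Finset (Fin n))} (hF : ¬ ContainsN F)
    {G : Set (Finset (Fin n))} (hG : IsComponent F G) {Y Z : Finset (Fin n)} (hZF : Z ∈ F)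
    (hZ : IsMiddle G Z) (hY : Y ∈ G) (h : Incomp Y Z) : IsMiddle G Y := by
  have hYF := (hG.mem_family hY).1
  constructor
  · intro B hB
    by_contra hBY
    obtain ⟨B₀, hB₀, hB₀Y⟩ := exists_isMinIn_subset hY
    have hBZ := hZ.1 B hB
    have hB₀Z := hZ.1 B₀ hB₀
    have hB₀B : ¬ B₀ ⊆ B := fun h' => hBY ((hB.subset_of_subset hB₀.1 h').trans hB₀Y)
    exact hF ⟨Z, Y, B, B₀, hZF, hYF, (hG.mem_family hB.1).1, (hG.mem_family hB₀.1).1,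
      ⟨hBZ, fun h' => hB₀B (hB₀Z.trans h')⟩, ⟨hB₀Z, fun h' => h.2 (h'.trans hB₀Y)⟩,
      ⟨hB₀Y, fun h' => h.1 (h'.trans hB₀Z)⟩, h.symm,
      ⟨hBY, fun h' => h.1 (h'.trans hBZ)⟩, ⟨fun h' => hBY (h'.trans hB₀Y), hB₀B⟩⟩
  · intro A hA
    by_contra hYA
    obtain ⟨A₀, hA₀, hYA₀⟩ := exists_isMaxIn_superset hY
    have hZA := hZ.2 A hA
    have hZA₀ := hZ.2 A₀ hA₀
    have hAA₀ : ¬ A ⊆ A₀ := fun h' => hYA (hYA₀.trans (hA.subset_of_subset hA₀.1 h'))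
    exact hF ⟨A₀, A, Y, Z, (hG.mem_family hA₀.1).1, (hG.mem_family hA.1).1, hYF, hZF,
      ⟨hYA₀, fun h' => h.2 (hZA₀.trans h')⟩, ⟨hZA₀, fun h' => h.1 (hYA₀.trans h')⟩,
      ⟨hZA, fun h' => hAA₀ (h'.trans hZA₀)⟩, ⟨fun h' => hYA (hYA₀.trans h'), hAA₀⟩,
      ⟨hYA, fun h' => h.2 (hZA.trans h')⟩, h⟩

/-- A middle set comparable to every member of a component of an `𝒩`-saturated family belongs
to the family. -/
theorem NSaturated.mem_of_comparable {F : Finset (Finset (Fin n))} (hF : NSaturated F)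
    {G : Set (Finset (Fin n))} (hG : IsComponent F G) {I : Finset (Fin n)} (hI : IsMiddle G I)
    (hcomp : ∀ Y ∈ G, Y ⊆ I ∨ I ⊆ Y) : I ∈ F := by
  by_contra hIF
  obtain ⟨X₀, hX₀⟩ := hG.nonempty
  obtain ⟨P, hP, -⟩ := exists_isMinIn_subset hX₀
  obtain ⟨Q, hQ, -⟩ := exists_isMaxIn_superset hX₀
  have hmem : ∀ Y ∈ insert I F, Y = I ∨ Y ∈ F := fun Y => Finset.mem_insert.1
  have key : ∀ Y Z, Z ∈ insert I F → (Y = I ∨ Y ∈ G) → (Y ⊆ Z ∨ Z ⊆ Y) →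
      Z ≠ ∅ → Z ≠ Finset.univ → Z = I ∨ Z ∈ G := by
    intro Y Z hZ hY h h0 h1
    rcases hmem Z hZ with hZI | hZF
    · exact .inl hZI
    right
    rcases hY with rfl | hY
    · rcases h with h | h
      · exact hG.mem_of_comparable hP.1 hZF h0 h1 (.inl ((hI.1 P hP).trans h))
      · exact hG.mem_of_comparable hQ.1 hZF h0 h1 (.inr (h.trans (hI.2 Q hQ)))
    · exact hG.mem_of_comparable hY hZF h0 h1 h
  have hinc : ∀ Y, (Y = I ∨ Y ∈ G) → ¬ Incomp Y I := by
    rintro Y (rfl | hY) h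
    · exact h.1 subset_rfl
    · exact (hcomp Y hY).elim h.1 h.2
  obtain ⟨A, B, C, D, hA, hB, hC, hD, hCA, hDA, hDB, hAB, hCB, hCD⟩ := hF.2 I hIF
  by_cases eA : A = I
  · have hD' := key A D hD (.inl eA) (.inr hDA.1) hCD.symm.ne_empty hCD.symm.ne_univ
    have hB' := key D B hB hD' (.inl hDB.1) hAB.symm.ne_empty hAB.symm.ne_univ
    exact hinc B hB' (eA ▸ hAB.symm)
  by_cases eB : B = I
  · have hD' := key B D hD (.inl eB) (.inr hDB.1) hCD.symm.ne_empty hCD.symm.ne_univ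
    have hA' := key D A hA hD' (.inl hDA.1) hAB.ne_empty hAB.ne_univ
    exact hinc A hA' (eB ▸ hAB)
  by_cases eC : C = I
  · have hA' := key C A hA (.inl eC) (.inl hCA.1) hAB.ne_empty hAB.ne_univ
    have hD' := key A D hD hA' (.inr hDA.1) hCD.symm.ne_empty hCD.symm.ne_univ
    exact hinc D hD' (eC ▸ hCD.symm)
  by_cases eD : D = I
  · have hA' := key D A hA (.inl eD) (.inl hDA.1) hAB.ne_empty hAB.ne_univ
    have hC' := key A C hC hA' (.inr hCA.1) hCD.ne_empty hCD.ne_univ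
    exact hinc C hC' (eD ▸ hCD)
  exact hF.1 ⟨A, B, C, D, (hmem A hA).resolve_left eA, (hmem B hB).resolve_left eB,
    (hmem C hC).resolve_left eC, (hmem D hD).resolve_left eD, hCA, hDA, hDB, hAB, hCB, hCD⟩

/-- let `G` be a component of the `𝒩`-saturated family `F` and let `M ∈ F`
lie above every minimal element of `G` and below every maximal element of `G`, with `M`
minimal with this property.  Then every `X ∈ G` is comparable to `M`. -/
theorem stmt11 (n : ℕ) (F : Finset (Finset (Fin n))) (hF : NSaturated F)
    (G : Set (Finset (Fin n))) (hG : IsComponent F G)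
    (M : Finset (Fin n)) (hM : M ∈ F)
    (hmid : (∀ B, IsMinIn G B → B ⊆ M) ∧ (∀ A, IsMaxIn G A → M ⊆ A))
    (hminimal : ∀ M' ∈ F, M' ⊂ M →
      ¬ ((∀ B, IsMinIn G B → B ⊆ M') ∧ (∀ A, IsMaxIn G A → M' ⊆ A))) :
    ∀ X ∈ G, X ⊆ M ∨ M ⊆ X := by
  classical
  let I : Finset (Fin n) := (F.filter (IsMiddle G)).inf id
  have hIle : ∀ Z ∈ F, IsMiddle G Z → I ⊆ Z := fun Z hZF hZ =>
    Finset.inf_le (f := id) (Finset.mem_filter.2 ⟨hZF, hZ⟩)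
  have hleI : ∀ Y, (∀ Z ∈ F, IsMiddle G Z → Y ⊆ Z) → Y ⊆ I := fun Y h =>
    Finset.le_inf fun Z hZ => h Z (Finset.mem_filter.1 hZ).1 (Finset.mem_filter.1 hZ).2
  have hIM : I ⊆ M := hIle M hM hmid
  have hI : IsMiddle G I :=
    ⟨fun B hB => hleI B fun Z _ hZ => hZ.1 B hB, fun A hA => hIM.trans (hmid.2 A hA)⟩
  have hcomp : ∀ Y ∈ G, Y ⊆ I ∨ I ⊆ Y := by
    intro Y hY
    by_cases hex : ∃ Z ∈ F, IsMiddle G Z ∧ Z ⊆ Y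
    · obtain ⟨Z, hZF, hZ, hZY⟩ := hex
      exact .inr ((hIle Z hZF hZ).trans hZY)
    · refine .inl (hleI Y fun Z hZF hZ => by_contra fun hYZ => hex ?_)
      by_cases hZY : Z ⊆ Y
      · exact ⟨Z, hZF, hZ, hZY⟩
      · exact ⟨Y, (hG.mem_family hY).1, hZ.of_incomp hF.1 hG hZF hY ⟨hYZ, hZY⟩, subset_rfl⟩
  have hIF : I ∈ F := hF.mem_of_comparable hG hI hcomp
  have hMI : M ⊆ I := by_contra fun h => hminimal I hIF ⟨hIM, h⟩ hI
  have hEq : I = M := hIM.antisymm hMI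
  exact hEq ▸ hcomp
end

section
/- Let ℱ be an 𝒩-saturated family of subsets of [n], let 𝒢 be a component of ℱ, and let M ∈ ℱ with 2·|M| ≤ n be comparable to every element of 𝒢 and minimal with this property (no M' ∈ ℱ with M' ⊊ M is comparable to every element of 𝒢). Then the number of indices i ∈ [n] for which there exists a set S_i with i ∉ S_i, S_i ∈ ℱ and S_i ∪ {i} ∈ ℱ is at least n/2 − |ℱ| + 2; equivalently, twice this number is at least n − 2·|ℱ| + 4. -/
variable {n : ℕ}

/-- Replacing a new set `X` by a comparable member `D` of `F` having the same comparabilities with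
the other members of `F` turns a copy of `𝒩` in `insert X F` into a copy in `F`. -/
lemma containsN_of_containsN_insert {F : Finset (Finset (Fin n))} {X D : Finset (Fin n)}
    (h : ContainsN (insert X F)) (hD : D ∈ F) (hXD : X ⊆ D ∨ D ⊆ X)
    (hle : ∀ W ∈ F, W ≠ D → (W ⊆ X ↔ W ⊆ D)) (hge : ∀ W ∈ F, W ≠ D → (X ⊆ W ↔ D ⊆ W)) :
    ContainsN F := by
  obtain ⟨A, B, C, E, hA, hB, hC, hE, hN⟩ := h
  simp only [IsNCopy, Incomp, ssubset_iff_subset_not_subset] at hN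
  have hrefl := Finset.Subset.refl X
  rw [Finset.mem_insert] at hA hB hC hE
  have hiff : ∀ W, W = X ∨ W ∈ F → W = X ∨ W = D ∨
      W ∈ F ∧ (W ⊆ X ↔ W ⊆ D) ∧ (X ⊆ W ↔ D ⊆ W) := fun W hW => by
    by_cases hWD : W = D
    · exact .inr (.inl hWD)
    · exact hW.imp_right fun hW => .inr ⟨hW, hle W hW hWD, hge W hW hWD⟩
  have hA' := hiff A hA
  have hB' := hiff B hB
  have hC' := hiff C hC
  have hE' := hiff E hE
  clear hle hge hiff
  unfold ContainsN
  simp only [IsNCopy, Incomp, ssubset_iff_subset_not_subset]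
  by_cases hAX : A = X
  · subst hAX
    refine ⟨D, B, C, E, ?_⟩
    rcases hB' with rfl | rfl | hB' <;> rcases hC' with rfl | rfl | hC' <;>
      rcases hE' with rfl | rfl | hE' <;> grind only
  by_cases hBX : B = X
  · subst hBX
    refine ⟨A, D, C, E, ?_⟩
    rcases hA' with rfl | rfl | hA' <;> rcases hC' with rfl | rfl | hC' <;>
      rcases hE' with rfl | rfl | hE' <;> grind only
  by_cases hCX : C = X
  · subst hCX
    refine ⟨A, B, D, E, ?_⟩
    rcases hA' with rfl | rfl | hA' <;> rcases hB' with rfl | rfl | hB' <;>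
      rcases hE' with rfl | rfl | hE' <;> grind only
  by_cases hEX : E = X
  · subst hEX
    refine ⟨A, B, C, D, ?_⟩
    rcases hA' with rfl | rfl | hA' <;> rcases hB' with rfl | rfl | hB' <;>
      rcases hC' with rfl | rfl | hC' <;> grind only
  exact ⟨A, B, C, E, hA.resolve_left hAX, hB.resolve_left hBX, hC.resolve_left hCX,
    hE.resolve_left hEX, hN⟩

/-- A set comparable to every member of an `𝒩`-saturated family belongs to it. -/
lemma NSaturated.mem_of_forall_comparable {F : Finset (Finset (Fin n))} (hF : NSaturated F)
    {X : Finset (Fin n)} (hX : ∀ W ∈ F, W ⊆ X ∨ X ⊆ W) : X ∈ F := by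
  by_contra hXF
  refine hF.1 ?_
  obtain ⟨A, B, C, E, hA, hB, hC, hE, hN⟩ := hF.2 X hXF
  refine ⟨A, B, C, E, ?_, ?_, ?_, ?_, hN⟩ <;>
  · simp only [IsNCopy, Incomp, ssubset_iff_subset_not_subset] at hN
    rw [Finset.mem_insert] at hA hB hC hE
    have hrefl := Finset.Subset.refl X
    grind

lemma NSaturated.exists_subset_insert_or_exists_ssuperset {F : Finset (Finset (Fin n))}
    (hF : NSaturated F) {D : Finset (Fin n)} {i : Fin n} (hD : D ∈ F) (hi : insert i D ∉ F) :
    (∃ Y ∈ F, i ∈ Y ∧ Y ⊆ insert i D) ∨ ∃ B ∈ F, D ⊂ B ∧ i ∉ B := by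
  by_contra! hcon
  obtain ⟨hY, hB⟩ := hcon
  refine hF.1 (containsN_of_containsN_insert (hF.2 _ hi) hD (.inr (Finset.subset_insert i D)) ?_ ?_)
  · intro W hW _
    refine ⟨fun h => ?_, fun h => h.trans (Finset.subset_insert i D)⟩
    exact (Finset.subset_insert_iff_of_notMem fun hiW => hY W hW hiW h).1 h
  · intro W hW hne
    refine ⟨fun h => (Finset.subset_insert i D).trans h, fun h => ?_⟩
    exact Finset.insert_subset (hB W hW (h.ssubset_of_ne hne.symm)) h

lemma NSaturated.exists_erase_subset_or_exists_ssubset {F : Finset (Finset (Fin n))}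
    (hF : NSaturated F) {E : Finset (Fin n)} {i : Fin n} (hE : E ∈ F) (hi : E.erase i ∉ F) :
    (∃ Z ∈ F, i ∉ Z ∧ E.erase i ⊆ Z) ∨ ∃ C ∈ F, C ⊂ E ∧ i ∈ C := by
  by_contra! hcon
  obtain ⟨hZ, hC⟩ := hcon
  refine hF.1 (containsN_of_containsN_insert (hF.2 _ hi) hE (.inl (Finset.erase_subset i E)) ?_ ?_)
  · intro W hW hne
    refine ⟨fun h => h.trans (Finset.erase_subset i E), fun h => ?_⟩
    exact Finset.subset_erase.2 ⟨h, hC W hW (h.ssubset_of_ne hne)⟩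
  · intro W hW _
    refine ⟨fun h => ?_, fun h => (Finset.erase_subset i E).trans h⟩
    have hiW : i ∈ W := by
      by_contra hiW
      exact hZ W hW hiW h
    exact fun j hj => by
      by_cases hji : j = i
      · exact hji ▸ hiW
      · exact h (Finset.mem_erase.2 ⟨hji, hj⟩)

/-- Between consecutive members `D ⊂ E` of an `𝒩`-saturated family, an index `i ∈ E \ D` such that
neither `insert i D` nor `E.erase i` is a member is isolated from below or from above. -/
lemma NSaturated.exists_of_consecutive {F : Finset (Finset (Fin n))} (hF : NSaturated F)
    {D E : Finset (Fin n)} {i : Fin n} (hD : D ∈ F) (hE : E ∈ F) (hDE : D ⊂ E)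
    (hcons : ∀ W ∈ F, D ⊂ W → ¬ W ⊂ E) (hiD : i ∉ D) (hiE : i ∈ E)
    (hiD' : insert i D ∉ F) (hiE' : E.erase i ∉ F) :
    (∃ Y ∈ F, i ∈ Y ∧ Y ⊆ insert i D) ∨ ∃ Z ∈ F, i ∉ Z ∧ E.erase i ⊆ Z := by
  rcases hF.exists_subset_insert_or_exists_ssuperset hD hiD' with h | ⟨B, hB, hDB, hiB⟩
  · exact .inl h
  rcases hF.exists_erase_subset_or_exists_ssubset hE hiE' with h | ⟨C, hC, hCE, hiC⟩
  · exact .inr h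
  have hDC : ¬ D ⊆ C := fun h =>
    hcons C hC (h.ssubset_of_ne fun h' => hiD (h' ▸ hiC)) hCE
  refine (hF.1 ⟨E, B, C, D, hE, hB, hC, hD, hCE, hDE, hDB, ⟨fun h => hiB (h hiE), fun h => ?_⟩,
    ⟨fun h => hiB (h hiC), fun h => hDC (hDB.1.trans h)⟩, ⟨fun h => hiD (h hiC), hDC⟩⟩).elim
  exact hcons B hB hDB (h.ssubset_of_ne fun h' => hiB (h' ▸ hiE))

/-- Around every index there is a pair of consecutive members of `F`, all from a single chain. -/
lemma exists_consecutive_around {F : Finset (Finset (Fin n))} (h0 : ∅ ∈ F)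
    (h1 : Finset.univ ∈ F) :
    ∃ D E : Fin n → Finset (Fin n), (∀ i, D i ∈ F ∧ E i ∈ F ∧ i ∉ D i ∧ i ∈ E i ∧ D i ⊂ E i ∧
      ∀ W ∈ F, D i ⊂ W → ¬ W ⊂ E i) ∧ (∀ i j, D i ⊆ D j ∨ D j ⊆ D i) ∧
      ∀ i j, E i ⊆ E j ∨ E j ⊆ E i := by
  classical
  have hempty : ∅ ∈ F.powerset.filter (fun K => ∀ V ∈ K, ∀ W ∈ K, V ⊆ W ∨ W ⊆ V) := by simp
  obtain ⟨K, hK, hKmax⟩ := Finset.exists_max_image _ Finset.card ⟨_, hempty⟩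
  simp only [Finset.mem_filter, Finset.mem_powerset] at hK hKmax
  obtain ⟨hKF, hchain⟩ := hK
  have hmem : ∀ W ∈ F, (∀ V ∈ K, V ⊆ W ∨ W ⊆ V) → W ∈ K := by
    intro W hW hcomp
    by_contra hWK
    have := hKmax (insert W K) ⟨Finset.insert_subset hW hKF, by
      intro V hV V' hV'
      have hrefl := Finset.Subset.refl W
      rw [Finset.mem_insert] at hV hV'
      grind⟩
    rw [Finset.card_insert_of_notMem hWK] at this
    omega
  have h0K : ∅ ∈ K := hmem _ h0 fun V _ => .inr (Finset.empty_subset V)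
  have h1K : Finset.univ ∈ K := hmem _ h1 fun V _ => .inl (Finset.subset_univ V)
  have hlow : ∀ i, ∃ D ∈ K, i ∉ D ∧ ∀ V ∈ K, i ∉ V → V ⊆ D := by
    intro i
    obtain ⟨D, hD, hDmax⟩ := Finset.exists_max_image (K.filter (i ∉ ·)) Finset.card
      ⟨∅, by simp [h0K]⟩
    simp only [Finset.mem_filter] at hD hDmax
    refine ⟨D, hD.1, hD.2, fun V hV hiV => ?_⟩
    rcases hchain V hV D hD.1 with h | h
    · exact h
    · exact (Finset.eq_of_subset_of_card_le h (hDmax V ⟨hV, hiV⟩)).ge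
  have hupp : ∀ i, ∃ E ∈ K, i ∈ E ∧ ∀ V ∈ K, i ∈ V → E ⊆ V := by
    intro i
    obtain ⟨E, hE, hEmin⟩ := Finset.exists_min_image (K.filter (i ∈ ·)) Finset.card
      ⟨Finset.univ, by simp [h1K]⟩
    simp only [Finset.mem_filter] at hE hEmin
    refine ⟨E, hE.1, hE.2, fun V hV hiV => ?_⟩
    rcases hchain E hE.1 V hV with h | h
    · exact h
    · exact (Finset.eq_of_subset_of_card_le h (hEmin V ⟨hV, hiV⟩)).ge
  choose D hDK hiD hDmax using hlow
  choose E hEK hiE hEmin using hupp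
  refine ⟨D, E, fun i => ⟨hKF (hDK i), hKF (hEK i), hiD i, hiE i, ?_, ?_⟩,
    fun i j => hchain _ (hDK i) _ (hDK j), fun i j => hchain _ (hEK i) _ (hEK j)⟩
  · rcases hchain _ (hDK i) _ (hEK i) with h | h
    · exact h.ssubset_of_ne fun h' => hiD i (h' ▸ hiE i)
    · exact (hiD i (h (hiE i))).elim
  · intro W hW hDW hWE
    have hWK : W ∈ K := hmem W hW fun V hV => by
      by_cases hiV : i ∈ V
      · exact .inr (hWE.1.trans (hEmin i V hV hiV))
      · exact .inl ((hDmax i V hV hiV).trans hDW.1)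
    by_cases hiW : i ∈ W
    · exact hWE.2 (hEmin i W hWK hiW)
    · exact hDW.2 (hDmax i W hWK hiW)

/-- In an `𝒩`-saturated family, all but at most `2 * |F| - 4` indices are the difference of two
members of the family. -/
lemma NSaturated.add_four_le {F : Finset (Finset (Fin n))} (hF : NSaturated F) (hn : 0 < n) :
    n + 4 ≤ {i : Fin n | ∃ S : Finset (Fin n), i ∉ S ∧ S ∈ F ∧ insert i S ∈ F}.ncard
      + 2 * F.card := by
  classical
  have h0 : ∅ ∈ F := hF.mem_of_forall_comparable fun W _ => .inr (Finset.empty_subset W)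
  have h1 : Finset.univ ∈ F := hF.mem_of_forall_comparable fun W _ => .inl (Finset.subset_univ W)
  obtain ⟨D, E, hDE, hDchain, hEchain⟩ := exists_consecutive_around h0 h1
  set good : Finset (Fin n) := {i | ∃ S : Finset (Fin n), i ∉ S ∧ S ∈ F ∧ insert i S ∈ F}
    with hgood
  have hncard : {i : Fin n | ∃ S : Finset (Fin n), i ∉ S ∧ S ∈ F ∧ insert i S ∈ F}.ncard
      = good.card := by
    rw [← Set.ncard_coe_finset]
    simp [hgood]
  have hDnot : ∀ i ∉ good, insert i (D i) ∉ F := fun i hi h =>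
    hi (by simpa [hgood] using ⟨D i, (hDE i).2.2.1, (hDE i).1, h⟩)
  have hEnot : ∀ i ∉ good, (E i).erase i ∉ F := fun i hi h =>
    hi (by
      simp only [hgood, Finset.mem_filter, Finset.mem_univ, true_and]
      exact ⟨_, Finset.notMem_erase i _, h,
        by rw [Finset.insert_erase (hDE i).2.2.2.1]; exact (hDE i).2.1⟩)
  set P : Finset (Fin n) := goodᶜ.filter fun i => ∃ Y ∈ F, i ∈ Y ∧ Y ⊆ insert i (D i) with hP
  set Q : Finset (Fin n) := goodᶜ.filter fun i => ∃ Z ∈ F, i ∉ Z ∧ (E i).erase i ⊆ Z with hQ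
  have hcover : goodᶜ ⊆ P ∪ Q := by
    intro i hi
    have hi' : i ∉ good := by simpa using hi
    obtain ⟨hD, hE, hiD, hiE, hlt, hcons⟩ := hDE i
    rw [Finset.mem_union, hP, hQ, Finset.mem_filter, Finset.mem_filter]
    exact (hF.exists_of_consecutive hD hE hlt hcons hiD hiE (hDnot i hi') (hEnot i hi')).imp
      (fun h => ⟨hi, h⟩) (fun h => ⟨hi, h⟩)
  have hne : (∅ : Finset (Fin n)) ≠ Finset.univ := fun h => by
    simpa [← h] using Finset.mem_univ (⟨0, hn⟩ : Fin n)
  have hcard : ((F.erase ∅).erase Finset.univ).card + 2 = F.card := by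
    rw [← Finset.card_erase_add_one h0,
      ← Finset.card_erase_add_one (Finset.mem_erase.2 ⟨hne.symm, h1⟩)]
  have hPcard : P.card ≤ ((F.erase ∅).erase Finset.univ).card := by
    refine Finset.card_le_card_of_forall_subsingleton (fun i Y => i ∈ Y ∧ Y ⊆ insert i (D i)) ?_ ?_
    · intro i hi
      rw [hP, Finset.mem_filter, Finset.mem_compl] at hi
      obtain ⟨hig, Y, hY, hiY, hYD⟩ := hi
      refine ⟨Y, ?_, hiY, hYD⟩
      simp only [Finset.mem_erase]
      refine ⟨?_, Finset.ne_empty_of_mem hiY, hY⟩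
      rintro rfl
      exact hDnot i hig (Finset.univ_subset_iff.1 hYD ▸ h1)
    · rintro Y - i ⟨-, hiY, hYi⟩ j ⟨-, hjY, hYj⟩
      have hi := (hDE i).2.2.1
      have hj := (hDE j).2.2.1
      have hji := Finset.mem_insert.1 (hYi hjY)
      have hij := Finset.mem_insert.1 (hYj hiY)
      rcases hDchain i j with h | h <;> grind
  have hQcard : Q.card ≤ ((F.erase ∅).erase Finset.univ).card := by
    refine Finset.card_le_card_of_forall_subsingleton (fun i Z => i ∉ Z ∧ (E i).erase i ⊆ Z) ?_ ?_
    · intro i hi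
      rw [hQ, Finset.mem_filter, Finset.mem_compl] at hi
      obtain ⟨hig, Z, hZ, hiZ, hEZ⟩ := hi
      refine ⟨Z, ?_, hiZ, hEZ⟩
      simp only [Finset.mem_erase]
      refine ⟨fun h => hiZ (h ▸ Finset.mem_univ i), ?_, hZ⟩
      rintro rfl
      exact hEnot i hig (Finset.subset_empty.1 hEZ ▸ h0)
    · rintro Z - i ⟨-, hiZ, hZi⟩ j ⟨-, hjZ, hZj⟩
      have hi := (hDE i).2.2.2.1
      have hj := (hDE j).2.2.2.1
      rcases hEchain i j with h | h <;> grind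
  have hbad := (Finset.card_le_card hcover).trans (Finset.card_union_le P Q)
  have htotal := Finset.card_add_card_compl good
  rw [Fintype.card_fin] at htotal
  omega

/-- let `G` be a component of the `𝒩`-saturated family `F`, and let
`M ∈ F` with `2·|M| ≤ n` be comparable to every element of `G` and minimal with this
property.  Then the number of indices `i` for which some `S_i ∈ F` satisfies `i ∉ S_i`
and `S_i ∪ {i} ∈ F` is at least `n/2 − |F| + 2`; equivalently, twice this number plus
`2·|F|` is at least `n + 4`. -/
theorem stmt18 (n : ℕ) (F : Finset (Finset (Fin n))) (hF : NSaturated F)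
    (G : Set (Finset (Fin n))) (hG : IsComponent F G)
    (M : Finset (Fin n)) (hM : M ∈ F) (hMcard : 2 * M.card ≤ n)
    (hcomp : ∀ X ∈ G, X ⊆ M ∨ M ⊆ X)
    (hminimal : ∀ M' ∈ F, M' ⊂ M → ¬ (∀ X ∈ G, X ⊆ M' ∨ M' ⊆ X)) :
    n + 4 ≤ 2 * {i : Fin n | ∃ S : Finset (Fin n),
      i ∉ S ∧ S ∈ F ∧ insert i S ∈ F}.ncard + 2 * F.card := by
  obtain ⟨X, -, hX, -⟩ := hG
  obtain ⟨i, -⟩ := Finset.nonempty_iff_ne_empty.2 hX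
  have := hF.add_four_le i.pos
  omega
end

section
/- Let n be a natural number, let I be a set of elements of [n], and for each i ∈ I let S_i ⊆ [n] be a set with i ∉ S_i. Consider the simple graph on the subsets of [n] in which two distinct sets X, Y are adjacent if and only if for some i ∈ I the pair {X, Y} equals {S_i, S_i ∪ {i}}. Then this graph is acyclic (it contains no cycle). -/
/-- The graph on the subsets of `[n]` in which two distinct sets `X, Y` are adjacent iff
for some `i ∈ I` the pair `{X, Y}` equals `{S_i, S_i ∪ {i}}`. -/
def valveGraph (n : ℕ) (I : Set (Fin n)) (S : Fin n → Finset (Fin n)) :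
    SimpleGraph (Finset (Fin n)) where
  Adj X Y := X ≠ Y ∧ ∃ i ∈ I,
    (X = S i ∧ Y = insert i (S i)) ∨ (Y = S i ∧ X = insert i (S i))
  symm := by
    constructor
    rintro X Y ⟨hne, i, hi, h⟩
    exact ⟨hne.symm, i, hi, h.symm⟩
  loopless := ⟨fun X h => h.1 rfl⟩

/-- Once the edge of direction `i` is removed, membership of `i` is constant along adjacency. -/
lemma valveGraph_deleteEdges_adj_mem_iff {n : ℕ} {I : Set (Fin n)} {S : Fin n → Finset (Fin n)}
    {i : Fin n} {X Y : Finset (Fin n)}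
    (h : ((valveGraph n I S).deleteEdges {s(S i, insert i (S i))}).Adj X Y) :
    i ∈ X ↔ i ∈ Y := by
  rw [SimpleGraph.deleteEdges_adj] at h
  obtain ⟨⟨-, j, -, ⟨rfl, rfl⟩ | ⟨rfl, rfl⟩⟩, hne⟩ := h
  all_goals
    have hij : i ≠ j := by
      rintro rfl
      simp [Sym2.eq_swap] at hne
    simp [hij]

/-- Every edge of the valve graph is a bridge. -/
lemma valveGraph_isBridge {n : ℕ} {I : Set (Fin n)} {S : Fin n → Finset (Fin n)}
    {i : Fin n} (hi : i ∉ S i) :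
    (valveGraph n I S).IsBridge s(S i, insert i (S i)) := by
  rw [SimpleGraph.isBridge_iff]
  rintro ⟨p⟩
  have mem_iff : ∀ {X Y} (_ : ((valveGraph n I S).deleteEdges
      {s(S i, insert i (S i))}).Walk X Y), i ∈ X ↔ i ∈ Y := by
    intro X Y q
    induction q with
    | nil => rfl
    | cons h _ ih => exact (valveGraph_deleteEdges_adj_mem_iff h).trans ih
  exact hi ((mem_iff p).2 (Finset.mem_insert_self _ _))

/-- if for each `i ∈ I ⊆ [n]` a set `S_i ⊆ [n]` with `i ∉ S_i` is chosen,
then the graph on subsets of `[n]` joining `S_i` to `S_i ∪ {i}` for each `i ∈ I` is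
acyclic. -/
theorem stmt19 (n : ℕ) (I : Set (Fin n)) (S : Fin n → Finset (Fin n))
    (hS : ∀ i ∈ I, i ∉ S i) :
    (valveGraph n I S).IsAcyclic := by
  rw [SimpleGraph.isAcyclic_iff_forall_adj_isBridge]
  rintro X Y ⟨-, i, hi, ⟨rfl, rfl⟩ | ⟨rfl, rfl⟩⟩
  · exact valveGraph_isBridge (hS i hi)
  · rw [Sym2.eq_swap]
    exact valveGraph_isBridge (hS i hi)
end
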